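/- arXiv:2106.02154 — 2 statements merged into one kernel-verified Lean document; each statement's English description precedes it below -/
import Mathlib

section
/- Let W be a symmetric n×n real matrix of weights on the vertex set {1,...,n}, and let A be a subset of {1,...,n} with both A and its complement A' nonempty. Define cut(A,A') = Σ_{i∈A} Σ_{j∈A'} W(i,j) and ratioCut(A,A') = cut(A,A')/|A| + cut(A,A')/|A'|. Define f ∈ ℝⁿ by f_i = √(|A'|/|A|) if i ∈ A and f_i = −√(|A|/|A'|) if i ∈ A'. Then Σ_{i=1}^n Σ_{j=1}^n W(i,j)(f_i − f_j)² = 2n · ratioCut(A,A'). -/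
/-- The ratio-cut identity: for the indicator-like vector `f`,
`∑ᵢ ∑ⱼ W i j (fᵢ - fⱼ)² = 2 n · ratioCut(A, Aᶜ)`. -/
theorem sum_weights_sq_diff_eq_ratioCut (n : ℕ)
    (W : Matrix (Fin n) (Fin n) ℝ) (hW : W.IsSymm)
    (A : Finset (Fin n)) (hA : A.Nonempty) (hA' : Aᶜ.Nonempty)
    (cut : ℝ) (hcut : cut = ∑ i ∈ A, ∑ j ∈ Aᶜ, W i j)
    (f : Fin n → ℝ)
    (hf : ∀ i, f i = if i ∈ A then Real.sqrt ((Aᶜ.card : ℝ) / (A.card : ℝ))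
                     else - Real.sqrt ((A.card : ℝ) / (Aᶜ.card : ℝ))) :
    ∑ i, ∑ j, W i j * (f i - f j) ^ 2
      = 2 * (n : ℝ) * (cut / (A.card : ℝ) + cut / (Aᶜ.card : ℝ)) := by
  have ha : (0 : ℝ) < A.card := by exact_mod_cast hA.card_pos
  have hb : (0 : ℝ) < Aᶜ.card := by exact_mod_cast hA'.card_pos
  have hn : (A.card : ℝ) + Aᶜ.card = n := by
    have h := Finset.card_add_card_compl A
    rw [Fintype.card_fin] at h
    exact_mod_cast h
  generalize hx : Real.sqrt ((Aᶜ.card : ℝ) / (A.card : ℝ)) = x at hf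
  generalize hy : Real.sqrt ((A.card : ℝ) / (Aᶜ.card : ℝ)) = y at hf
  have hx2 : x ^ 2 = (Aᶜ.card : ℝ) / A.card := by
    rw [← hx]; exact Real.sq_sqrt (by positivity)
  have hy2 : y ^ 2 = (A.card : ℝ) / Aᶜ.card := by
    rw [← hy]; exact Real.sq_sqrt (by positivity)
  have hxy : x * y = 1 := by
    rw [← hx, ← hy, ← Real.sqrt_mul (by positivity)]
    rw [Real.sqrt_eq_one]
    field_simp
  have hc : (x + y) ^ 2 = (n : ℝ) * (1 / (A.card : ℝ) + 1 / (Aᶜ.card : ℝ)) := by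
    have : (x + y) ^ 2 = x ^ 2 + y ^ 2 + 2 * (x * y) := by ring
    rw [this, hx2, hy2, hxy, ← hn]
    field_simp
    ring
  have h1 : ∀ i ∈ A, ∑ j, W i j * (f i - f j) ^ 2 = (∑ j ∈ Aᶜ, W i j) * (x + y) ^ 2 := by
    intro i hi
    rw [← Finset.sum_add_sum_compl A, Finset.sum_eq_zero, zero_add, Finset.sum_mul]
    · refine Finset.sum_congr rfl fun j hj => ?_
      rw [hf i, hf j, if_pos hi, if_neg (Finset.mem_compl.mp hj)]
      ring
    · intro j hj
      rw [hf i, hf j, if_pos hi, if_pos hj]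
      ring
  have h2 : ∀ i ∈ Aᶜ, ∑ j, W i j * (f i - f j) ^ 2 = (∑ j ∈ A, W j i) * (x + y) ^ 2 := by
    intro i hi
    have hi' := Finset.mem_compl.mp hi
    rw [← Finset.sum_add_sum_compl A, add_comm, Finset.sum_eq_zero, zero_add, Finset.sum_mul]
    · refine Finset.sum_congr rfl fun j hj => ?_
      rw [hf i, hf j, if_neg hi', if_pos hj, hW.apply j i]
      ring
    · intro j hj
      rw [hf i, hf j, if_neg hi', if_neg (Finset.mem_compl.mp hj)]
      ring
  rw [← Finset.sum_add_sum_compl A, Finset.sum_congr rfl h1, Finset.sum_congr rfl h2,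
    ← Finset.sum_mul, ← Finset.sum_mul, Finset.sum_comm (s := Aᶜ), ← hcut, hc]
  ring
end

section
/- Let L be a symmetric n×n real matrix and D a diagonal n×n matrix with strictly positive diagonal entries, and let p ≤ n. Then the minimum of tr(Fᵀ L F) over all n×p real matrices F satisfying Fᵀ D F = I_p equals the sum of the p smallest eigenvalues of the symmetric matrix D^{−1/2} L D^{−1/2} (eigenvalues listed in ascending order with multiplicity). -/
open Matrix

lemma aux_weight_le_one {n p : ℕ} (G : Matrix (Fin n) (Fin p) ℝ) (hG : Gᵀ * G = 1) (i : Fin n) :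
    ∑ k, G i k ^ 2 ≤ 1 := by
  have hPP : (G * Gᵀ) * (G * Gᵀ) = G * Gᵀ := by
    rw [Matrix.mul_assoc, ← Matrix.mul_assoc Gᵀ, hG, Matrix.one_mul]
  have hsym : ∀ j, (G * Gᵀ) j i = (G * Gᵀ) i j := fun j => by
    simp [Matrix.mul_apply, mul_comm]
  have h1 : ∑ j, (G * Gᵀ) i j ^ 2 = (G * Gᵀ) i i := by
    conv_rhs => rw [← hPP, Matrix.mul_apply]
    exact Finset.sum_congr rfl fun j _ => by rw [hsym j, sq]
  have h2 : (G * Gᵀ) i i ^ 2 ≤ ∑ j, (G * Gᵀ) i j ^ 2 :=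
    Finset.single_le_sum (f := fun j => (G * Gᵀ) i j ^ 2) (fun j _ => sq_nonneg _)
      (Finset.mem_univ i)
  have h3 : (G * Gᵀ) i i = ∑ k, G i k ^ 2 := by
    simp [Matrix.mul_apply, sq]
  rw [h1] at h2
  rw [← h3]
  nlinarith

lemma aux_sum_castLE {n p : ℕ} (hp : p ≤ n) (f : Fin n → ℝ) :
    ∑ i : Fin n, (if (i : ℕ) < p then f i else 0) = ∑ k : Fin p, f (Fin.castLE hp k) := by
  obtain ⟨m, rfl⟩ := Nat.exists_eq_add_of_le hp
  rw [Fin.sum_univ_add]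
  simp
  rfl

lemma aux_trace {n p : ℕ} (G : Matrix (Fin n) (Fin p) ℝ) (μ : Fin n → ℝ) :
    (Gᵀ * Matrix.diagonal μ * G).trace = ∑ i, μ i * ∑ k, G i k ^ 2 := by
  simp only [Matrix.trace, Matrix.diag, Matrix.mul_apply (M := Gᵀ * Matrix.diagonal μ),
    Matrix.mul_diagonal, Matrix.transpose_apply]
  rw [Finset.sum_comm]
  refine Finset.sum_congr rfl fun i _ => ?_
  rw [Finset.mul_sum]
  exact Finset.sum_congr rfl fun k _ => by ring

lemma aux_lower {n p : ℕ} (hp : p ≤ n) (μ : Fin n → ℝ) (hmono : Monotone μ)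
    (G : Matrix (Fin n) (Fin p) ℝ) (hG : Gᵀ * G = 1) :
    ∑ k : Fin p, μ (Fin.castLE hp k) ≤ (Gᵀ * Matrix.diagonal μ * G).trace := by
  rcases Nat.eq_zero_or_pos p with rfl | hpos
  · simp [Matrix.trace]
  have hw1 := aux_weight_le_one G hG
  have hw0 : ∀ i, 0 ≤ ∑ k, G i k ^ 2 := fun i => Finset.sum_nonneg fun k _ => sq_nonneg _
  have hs : ∑ i, ∑ k, G i k ^ 2 = (p : ℝ) := by
    have := aux_trace G (fun _ => 1)
    simp only [Matrix.diagonal_one, Matrix.mul_one, hG, Matrix.trace_one, Fintype.card_fin,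
      one_mul] at this
    exact this.symm
  have hc : ∑ i : Fin n, (if (i : ℕ) < p then (1 : ℝ) else 0) = p := by
    rw [aux_sum_castLE hp (fun _ => 1)]
    simp
  rw [aux_trace, ← aux_sum_castLE hp μ]
  set w : Fin n → ℝ := fun i => ∑ k, G i k ^ 2 with hw
  let m := μ ⟨p - 1, by omega⟩
  have key : 0 ≤ ∑ i : Fin n, (μ i - m) * (w i - if (i : ℕ) < p then (1 : ℝ) else 0) := by
    refine Finset.sum_nonneg fun i _ => ?_
    split_ifs with h
    · have : μ i ≤ m := hmono (by rw [Fin.le_def]; simp only; omega)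
      exact mul_nonneg_of_nonpos_of_nonpos (by linarith) (by linarith [hw1 i])
    · have : m ≤ μ i := hmono (by rw [Fin.le_def]; simp only; omega)
      exact mul_nonneg (by linarith) (by linarith [hw0 i])
  have e : ∑ i : Fin n, (μ i - m) * (w i - if (i : ℕ) < p then (1 : ℝ) else 0)
      = (∑ i, μ i * w i) - (∑ i : Fin n, if (i : ℕ) < p then μ i else 0)
        - m * (∑ i, w i) + m * ∑ i : Fin n, (if (i : ℕ) < p then (1 : ℝ) else 0) := by
    rw [Finset.mul_sum, Finset.mul_sum, ← Finset.sum_sub_distrib, ← Finset.sum_sub_distrib,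
      ← Finset.sum_add_distrib]
    refine Finset.sum_congr rfl fun i _ => ?_
    split_ifs <;> ring
  have hs' : ∑ i, w i = (p : ℝ) := hs
  rw [e, hc, hs'] at key
  linarith

/-- The minimum of `tr(Fᵀ L F)` over `F` with `Fᵀ D F = I` equals the sum of
the `p` smallest eigenvalues (ascending `μ`, given via a spectral decomposition)
of the symmetric matrix `D^{-1/2} L D^{-1/2}`. -/
theorem trace_min_degree_normalized (n p : ℕ) (hp : p ≤ n)
    (L : Matrix (Fin n) (Fin n) ℝ) (hL : L.IsSymm)
    (d : Fin n → ℝ) (hd : ∀ i, 0 < d i)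
    (μ : Fin n → ℝ) (hmono : Monotone μ)
    (Q : Matrix (Fin n) (Fin n) ℝ) (hQ : Qᵀ * Q = 1)
    (hspec : Matrix.diagonal (fun i => (Real.sqrt (d i))⁻¹) * L *
               Matrix.diagonal (fun i => (Real.sqrt (d i))⁻¹)
             = Q * Matrix.diagonal μ * Qᵀ) :
    IsLeast {t : ℝ | ∃ F : Matrix (Fin n) (Fin p) ℝ,
        Fᵀ * Matrix.diagonal d * F = 1 ∧ t = (Fᵀ * L * F).trace}
      (∑ k : Fin p, μ (Fin.castLE hp k)) := by
  have hne : ∀ i, Real.sqrt (d i) ≠ 0 := fun i => (Real.sqrt_pos.2 (hd i)).ne'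
  have hQ' : Q * Qᵀ = 1 := mul_eq_one_comm.1 hQ
  set T := Matrix.diagonal (fun i => (Real.sqrt (d i))⁻¹) with hT
  set S := Matrix.diagonal (fun i => Real.sqrt (d i)) with hS
  have hST : S * T = 1 := by
    rw [hS, hT, Matrix.diagonal_mul_diagonal, ← Matrix.diagonal_one]
    congr 1; ext i; exact mul_inv_cancel₀ (hne i)
  have hTS : T * S = 1 := mul_eq_one_comm.1 hST
  have hSS : Matrix.diagonal d = S * S := by
    rw [hS, Matrix.diagonal_mul_diagonal]
    congr 1; ext i; exact (Real.mul_self_sqrt (hd i).le).symm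
  have hSt : Sᵀ = S := Matrix.diagonal_transpose _
  have hTt : Tᵀ = T := Matrix.diagonal_transpose _
  have hLeq : L = S * (Q * Matrix.diagonal μ * Qᵀ) * S := by
    rw [← hspec]
    calc L = (S * T) * L * (T * S) := by rw [hST, hTS, Matrix.one_mul, Matrix.mul_one]
      _ = _ := by simp only [Matrix.mul_assoc]
  -- change of variables
  have h1 : ∀ F : Matrix (Fin n) (Fin p) ℝ,
      (Qᵀ * S * F)ᵀ * (Qᵀ * S * F) = Fᵀ * Matrix.diagonal d * F := fun F => by
    calc _ = Fᵀ * S * (Q * Qᵀ) * S * F := by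
          simp only [Matrix.transpose_mul, Matrix.transpose_transpose, hSt, Matrix.mul_assoc]
      _ = _ := by rw [hQ', hSS]; simp only [Matrix.mul_one, Matrix.mul_assoc]
  have h2 : ∀ F : Matrix (Fin n) (Fin p) ℝ,
      (Qᵀ * S * F)ᵀ * Matrix.diagonal μ * (Qᵀ * S * F) = Fᵀ * L * F := fun F => by
    rw [hLeq]
    simp only [Matrix.transpose_mul, Matrix.transpose_transpose, hSt, Matrix.mul_assoc]
  constructor
  · let G : Matrix (Fin n) (Fin p) ℝ := fun i k => if i = Fin.castLE hp k then 1 else 0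
    have hG : Gᵀ * G = 1 := by
      ext k l
      rw [Matrix.mul_apply, Matrix.one_apply]
      simp only [Matrix.transpose_apply]
      simp only [G, mul_ite, mul_one, mul_zero, Finset.sum_ite_eq', Finset.sum_ite_eq,
        Finset.mem_univ, if_true, Fin.castLE_inj]
      simp only [eq_comm]
    have hF : Qᵀ * S * (T * Q * G) = G := by
      calc _ = Qᵀ * (S * T) * Q * G := by simp only [Matrix.mul_assoc]
        _ = G := by rw [hST, Matrix.mul_one, hQ, Matrix.one_mul]
    refine ⟨T * Q * G, ?_, ?_⟩
    · rw [← h1, hF, hG]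
    · rw [← h2, hF, aux_trace]
      simp only [Finset.mul_sum]
      rw [Finset.sum_comm]
      refine Finset.sum_congr rfl fun k _ => ?_
      simp [G]
  · rintro t ⟨F, hF, rfl⟩
    rw [← h2]
    exact aux_lower hp μ hmono _ (by rw [h1, hF])
end
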